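/- Suppose that to every α-Hölder function g: Ω → ℝ there are assigned λ_g > 0 and a strictly positive α-Hölder function h_g with L_g h_g = λ_g h_g, and define h^v(μ) = inf over all α-Hölder g of { −∫_Ω g dμ + log λ_g }. Then for every shift-invariant Borel probability measure μ on Ω, the specific entropy satisfies h^s(μ) = h^v(μ) (as elements of [−∞,0]). -/

import Mathlib

open MeasureTheory Filter
open scoped Classical

noncomputable section

namespace Paper

variable {A : Type*} [MetricSpace A] [CompactSpace A] [MeasurableSpace A] [BorelSpace A]

/-- The left shift `σ` on `Ω = Aᴺ`. -/
def shift (x : ℕ → A) : ℕ → A := fun n => x (n + 1)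

/-- Prepend a symbol: `cons a x = (a, x₀, x₁, …)`. -/
def cons (a : A) (x : ℕ → A) : ℕ → A := fun n =>
  match n with
  | 0 => a
  | n + 1 => x n

/-- The metric `d_Ω` on `Ω`. -/
def dOmega (x y : ℕ → A) : ℝ :=
  ∑' n : ℕ, (1 / 2 : ℝ) ^ (n + 1) * (dist (x n) (y n) / (1 + dist (x n) (y n)))

/-- `f` is `α`-Hölder with respect to `d_Ω`. -/
def IsHolder (α : ℝ) (f : (ℕ → A) → ℝ) : Prop :=
  ∃ C : ℝ, 0 ≤ C ∧ ∀ x y, |f x - f y| ≤ C * dOmega x y ^ α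

/-- The Ruelle transfer operator with a priori measure `p`. -/
def ruelle (p : Measure A) (f φ : (ℕ → A) → ℝ) : (ℕ → A) → ℝ :=
  fun x => ∫ a, Real.exp (f (cons a x)) * φ (cons a x) ∂p

/-- The normalized potential `f̄ = f + log h - log (h ∘ σ) - log λ`. -/
def fbar (f h : (ℕ → A) → ℝ) (lam : ℝ) : (ℕ → A) → ℝ :=
  fun x => f x + Real.log (h x) - Real.log (h (shift x)) - Real.log lam

/-- Projection on the first `n` coordinates. -/
def proj (n : ℕ) (x : ℕ → A) : Fin n → A := fun i => x i

/-- Relative entropy `H(μ|ν)` of two measures, with value `+∞` unless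
`μ ≪ ν` and the entropy integral is finite. -/
def relEnt {X : Type*} [MeasurableSpace X] (μ ν : Measure X) : EReal :=
  if μ ≪ ν ∧ Integrable (fun x => Real.log (μ.rnDeriv ν x).toReal) μ then
    ((∫ x, Real.log (μ.rnDeriv ν x).toReal ∂μ : ℝ) : EReal)
  else ⊤

/-- Relative entropy `H_{Λ_n}(μ|ν)` on the σ-algebra of the first `n` coordinates. -/
def relEntN (n : ℕ) (μ ν : Measure (ℕ → A)) : EReal :=
  relEnt (μ.map (proj n)) (ν.map (proj n))

/-- The entropy `H_{Λ_n}(μ) = -H_{Λ_n}(μ | pᴺ)` relative to the a priori measure `p`. -/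
def finEnt (p : Measure A) (μ : Measure (ℕ → A)) (n : ℕ) : EReal :=
  - relEnt (μ.map (proj n)) (Measure.pi fun _ : Fin n => p)

/-- The specific entropy `h^s(μ) = lim_n H_{Λ_n}(μ)/n` (defined as a `limsup`,
which coincides with the limit whenever the latter exists). -/
def specEnt (p : Measure A) (μ : Measure (ℕ → A)) : EReal :=
  Filter.atTop.limsup fun n : ℕ => ((n : ℝ)⁻¹ : EReal) * finEnt p μ n

/-- Birkhoff sum `S_n(f)`. -/
def birkhoff (n : ℕ) (f : (ℕ → A) → ℝ) (x : ℕ → A) : ℝ :=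
  ∑ i ∈ Finset.range n, f (shift^[i] x)

/-- The configuration `x_{Λ_n} y_{Λ_n^c}`. -/
def concatAt (n : ℕ) (x y : ℕ → A) : ℕ → A := fun i => if i < n then x i else y i

/-- Concatenation of a finite word with a configuration. -/
def wordCons (n : ℕ) (a : Fin n → A) (x : ℕ → A) : ℕ → A :=
  fun i => if h : i < n then a ⟨i, h⟩ else x (i - n)

/-- The entropy `h^v(μ) = inf_g { -∫ g dμ + log λ_g }`, the infimum being taken over
all `α`-Hölder potentials `g`, where `λ_g` is the maximal eigenvalue of `L_g`. -/
def hvEnt (α : ℝ) (lam : ((ℕ → A) → ℝ) → ℝ) (μ : Measure (ℕ → A)) : EReal :=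
  sInf {c : EReal | ∃ g : (ℕ → A) → ℝ, IsHolder α g ∧
    c = ((-∫ x, g x ∂μ + Real.log (lam g) : ℝ) : EReal)}

set_option linter.unusedSectionVars false

/-- The Gibbs inequality: the easy half of the Donsker-Varadhan variational formula. -/
theorem integral_sub_log_integral_exp_le_relEnt {X : Type*} [MeasurableSpace X]
    (μ ν : Measure X) [IsProbabilityMeasure μ] [IsProbabilityMeasure ν] {φ : X → ℝ}
    (hφμ : Integrable φ μ) (hφν : Integrable (fun x => Real.exp (φ x)) ν) :
    ((∫ x, φ x ∂μ - Real.log (∫ x, Real.exp (φ x) ∂ν) : ℝ) : EReal) ≤ relEnt μ ν := by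
  unfold relEnt
  split_ifs with h
  · obtain ⟨hac, hint⟩ := h
    have hint : Integrable (llr μ ν) μ := hint
    have : IsProbabilityMeasure (ν.tilted φ) := isProbabilityMeasure_tilted hφν
    have h1 := integral_llr_tilted_right hac hφμ hφν hint
    have h2 := InformationTheory.integral_llr_add_sub_measure_univ_nonneg
      (hac.trans (absolutelyContinuous_tilted hφν))
      (integrable_llr_tilted_right hac hφμ hint hφν)
    simp only [probReal_univ, add_sub_cancel_right] at h2
    rw [h1] at h2
    simp only [llr] at h2
    exact EReal.coe_le_coe_iff.2 (by linarith)
  · exact le_top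

/-- A continuous function on a compact metric space is a uniform limit of Lipschitz functions. -/
theorem exists_lipschitzWith_abs_sub_le {X : Type*} [PseudoMetricSpace X] [CompactSpace X]
    {φ : X → ℝ} (hφ : Continuous φ) {ε : ℝ} (hε : 0 < ε) :
    ∃ ψ : X → ℝ, (∃ K, LipschitzWith K ψ) ∧ ∀ x, |ψ x - φ x| ≤ ε := by
  obtain ⟨M, hM⟩ : ∃ M, ∀ x, |φ x| ≤ M := by
    obtain ⟨M, hM⟩ := isCompact_univ.exists_bound_of_continuousOn hφ.continuousOn
    exact ⟨M, fun x => hM x (Set.mem_univ x)⟩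
  obtain ⟨δ, hδ, hδε⟩ := Metric.uniformContinuous_iff.1
    (CompactSpace.uniformContinuous_of_continuous hφ) ε hε
  set K : ℝ := 2 * |M| / δ with hK
  have hK0 : 0 ≤ K := by positivity
  have hbdd : ∀ x, BddBelow (Set.range fun y => φ y + K * dist x y) := fun x =>
    ⟨-M, by
      rintro _ ⟨y, rfl⟩
      have := neg_le_of_abs_le (hM y)
      have : 0 ≤ K * dist x y := by positivity
      dsimp only
      linarith⟩
  refine ⟨fun x => ⨅ y, φ y + K * dist x y, ⟨K.toNNReal, ?_⟩, fun x => ?_⟩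
  · refine LipschitzWith.of_le_add_mul _ fun x z => ?_
    have : Nonempty X := ⟨x⟩
    rw [← sub_le_iff_le_add]
    refine le_ciInf fun y => ?_
    have h1 : (⨅ y, φ y + K * dist x y) ≤ φ y + K * dist x y := ciInf_le (hbdd x) y
    have h2 : K * dist x y ≤ K * (dist x z + dist z y) :=
      mul_le_mul_of_nonneg_left (dist_triangle _ _ _) hK0
    rw [Real.coe_toNNReal _ hK0]
    linarith
  · have : Nonempty X := ⟨x⟩
    have h1 : (⨅ y, φ y + K * dist x y) ≤ φ x := by
      simpa using ciInf_le (hbdd x) x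
    have h2 : φ x - ε ≤ ⨅ y, φ y + K * dist x y := by
      refine le_ciInf fun y => ?_
      rcases lt_or_ge (dist x y) δ with h | h
      · have h3 := hδε h
        rw [Real.dist_eq] at h3
        have := (abs_lt.1 h3).2
        have : 0 ≤ K * dist x y := by positivity
        linarith
      · have h3 : K * δ ≤ K * dist x y := mul_le_mul_of_nonneg_left h hK0
        have h4 : K * δ = 2 * |M| := by rw [hK]; field_simp
        have := neg_le_of_abs_le (hM y)
        have := le_of_abs_le (hM x)
        have := le_abs_self M
        linarith
    rw [abs_le]
    constructor <;> linarith

theorem abs_exp_sub_exp_le {a b M : ℝ} (ha : |a| ≤ M) (hb : |b| ≤ M) :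
    |Real.exp a - Real.exp b| ≤ Real.exp M * |a - b| := by
  have := (convex_Icc (-M) M).norm_image_sub_le_of_norm_deriv_le (f := Real.exp) (C := Real.exp M)
    (fun x _ => Real.differentiableAt_exp)
    (fun x hx => by
      simpa using hx.2) (abs_le.1 hb) (abs_le.1 ha)
  simpa using this

/-- If the Donsker-Varadhan functional is bounded on Lipschitz functions, it satisfies the same
bound on bounded measurable functions. -/
theorem integral_le_add_log_integral_exp_of_lipschitzWith {X : Type*} [MetricSpace X]
    [CompactSpace X] [MeasurableSpace X] [BorelSpace X] {μ ν : Measure X} [IsProbabilityMeasure μ]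
    [IsProbabilityMeasure ν] {c : ℝ}
    (h : ∀ φ : X → ℝ, (∃ K, LipschitzWith K φ) →
      ∫ x, φ x ∂μ ≤ c + Real.log (∫ x, Real.exp (φ x) ∂ν))
    {φ : X → ℝ} (hφ : Measurable φ) {M : ℝ} (hM : ∀ x, |φ x| ≤ M) :
    ∫ x, φ x ∂μ ≤ c + Real.log (∫ x, Real.exp (φ x) ∂ν) := by
  have hbint : ∀ (ρ : Measure X) [IsFiniteMeasure ρ] (f : X → ℝ) (B : ℝ), Measurable f →
      (∀ x, |f x| ≤ B) → Integrable f ρ := fun ρ _ f B hf hB =>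
    Integrable.of_bound hf.aestronglyMeasurable B (ae_of_all _ hB)
  have hbexp : ∀ (ρ : Measure X) [IsFiniteMeasure ρ] (f : X → ℝ) (B : ℝ), Measurable f →
      (∀ x, |f x| ≤ B) → Integrable (fun x => Real.exp (f x)) ρ := fun ρ _ f B hf hB =>
    hbint ρ _ (Real.exp B) (Real.measurable_exp.comp hf) fun x => by
      rw [abs_of_pos (Real.exp_pos _)]
      exact Real.exp_le_exp.2 (le_of_abs_le (hB x))
  have hX : Nonempty X := (Measure.nonempty_of_neZero μ)
  have hM0 : 0 ≤ M := (abs_nonneg _).trans (hM hX.some)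
  -- the bound for continuous functions
  have hcont : ∀ ψ : X → ℝ, Continuous ψ → ∫ x, ψ x ∂μ ≤
      c + Real.log (∫ x, Real.exp (ψ x) ∂ν) := by
    intro ψ hψ
    obtain ⟨B, hB⟩ : ∃ B, ∀ x, |ψ x| ≤ B := by
      obtain ⟨M, hM⟩ := isCompact_univ.exists_bound_of_continuousOn hψ.continuousOn
      exact ⟨M, fun x => hM x (Set.mem_univ x)⟩
    refine le_of_forall_pos_le_add fun ε hε => ?_
    obtain ⟨χ, ⟨K, hK⟩, hχ⟩ := exists_lipschitzWith_abs_sub_le hψ (half_pos hε)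
    have hχB : ∀ x, |χ x| ≤ B + ε / 2 := fun x => by
      have := abs_le.1 (hχ x)
      have := abs_le.1 (hB x)
      rw [abs_le]
      constructor <;> linarith
    have h1 := h χ ⟨K, hK⟩
    have h2 : ∫ x, ψ x ∂μ ≤ ∫ x, (χ x + ε / 2) ∂μ :=
      integral_mono (hbint μ _ B hψ.measurable hB)
        ((hbint μ _ _ hK.continuous.measurable hχB).add (integrable_const _)) fun x => by
          have := abs_le.1 (hχ x)
          dsimp only
          linarith
    rw [integral_add (hbint μ _ _ hK.continuous.measurable hχB) (integrable_const _)] at h2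
    simp only [integral_const, probReal_univ, one_smul] at h2
    have hpos : 0 < ∫ x, Real.exp (χ x) ∂ν :=
      integral_exp_pos (hbexp ν _ _ hK.continuous.measurable hχB)
    have hpos' : 0 < ∫ x, Real.exp (ψ x) ∂ν := integral_exp_pos (hbexp ν _ _ hψ.measurable hB)
    have h3 : ∫ x, Real.exp (χ x) ∂ν ≤ Real.exp (ε / 2) * ∫ x, Real.exp (ψ x) ∂ν := by
      rw [← integral_const_mul]
      refine integral_mono (hbexp ν _ _ hK.continuous.measurable hχB)
        ((hbexp ν _ _ hψ.measurable hB).const_mul _) fun x => ?_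
      dsimp only
      rw [← Real.exp_add]
      have := abs_le.1 (hχ x)
      exact Real.exp_le_exp.2 (by linarith)
    have h4 := Real.log_le_log hpos h3
    rw [Real.log_mul (Real.exp_pos _).ne' hpos'.ne', Real.log_exp] at h4
    linarith
  -- approximation in `L¹(μ + ν)`
  have hposφ : 0 < ∫ x, Real.exp (φ x) ∂ν := integral_exp_pos (hbexp ν _ _ hφ hM)
  have key : ∀ ε : ℝ, 0 < ε → ∫ x, φ x ∂μ ≤
      ε + (c + Real.log (∫ x, Real.exp (φ x) ∂ν + Real.exp M * ε)) := by
    intro ε hε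
    obtain ⟨g, hg, -⟩ := (hbint (μ + ν) φ M hφ hM).exists_boundedContinuous_integral_sub_le hε
    set ψ : X → ℝ := fun x => max (-M) (min M (g x)) with hψdef
    have hψ : Continuous ψ := by fun_prop
    have hψM : ∀ x, |ψ x| ≤ M := fun x => by
      rw [abs_le]
      exact ⟨le_max_left _ _, max_le (by linarith) (min_le_left _ _)⟩
    have hclose : ∀ x, |φ x - ψ x| ≤ ‖φ x - g x‖ := fun x => by
      have hx := abs_le.1 (hM x)
      have h1 : φ x = max (-M) (min M (φ x)) := by
        rw [min_eq_right hx.2, max_eq_right hx.1]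
      rw [Real.norm_eq_abs]
      calc |φ x - ψ x| = |max (-M) (min M (φ x)) - max (-M) (min M (g x))| := by rw [← h1]
        _ ≤ |min M (φ x) - min M (g x)| := by
          simpa using abs_max_sub_max_le_max (-M) (min M (φ x)) (-M) (min M (g x))
        _ ≤ _ := by simpa using abs_min_sub_min_le_max M (φ x) M (g x)
    have hi : ∀ (ρ : Measure X) [IsFiniteMeasure ρ], Integrable (fun x => |φ x - ψ x|) ρ :=
      fun ρ _ => ((hbint ρ _ _ hφ hM).sub (hbint ρ _ _ hψ.measurable hψM)).abs
    have hsum : ∫ x, |φ x - ψ x| ∂μ + ∫ x, |φ x - ψ x| ∂ν ≤ ε := by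
      rw [← integral_add_measure (hi μ) (hi ν)]
      refine le_trans (integral_mono (hi _) ?_ hclose) hg
      exact ((hbint (μ + ν) φ M hφ hM).sub (g.integrable (μ + ν))).norm
    have hn1 : 0 ≤ ∫ x, |φ x - ψ x| ∂μ := integral_nonneg fun _ => abs_nonneg _
    have hn2 : 0 ≤ ∫ x, |φ x - ψ x| ∂ν := integral_nonneg fun _ => abs_nonneg _
    have h1 : ∫ x, φ x ∂μ - ∫ x, ψ x ∂μ ≤ ε := by
      rw [← integral_sub (hbint μ _ _ hφ hM) (hbint μ _ _ hψ.measurable hψM)]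
      refine (integral_mono ?_ (hi μ) fun x => le_abs_self _).trans (by linarith)
      exact (hbint μ _ _ hφ hM).sub (hbint μ _ _ hψ.measurable hψM)
    have h2 : ∫ x, Real.exp (ψ x) ∂ν ≤ ∫ x, Real.exp (φ x) ∂ν + Real.exp M * ε := by
      have : ∫ x, Real.exp (ψ x) ∂ν ≤ ∫ x, (Real.exp (φ x) + Real.exp M * |φ x - ψ x|) ∂ν := by
        refine integral_mono (hbexp ν _ _ hψ.measurable hψM)
          ((hbexp ν _ _ hφ hM).add ((hi ν).const_mul _)) fun x => ?_
        have := (le_abs_self _).trans (abs_exp_sub_exp_le (hψM x) (hM x))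
        rw [abs_sub_comm] at this
        dsimp only
        linarith
      rw [integral_add (hbexp ν _ _ hφ hM) ((hi ν).const_mul _), integral_const_mul] at this
      refine this.trans ?_
      gcongr
      linarith
    have h3 := Real.log_le_log (integral_exp_pos (hbexp ν _ _ hψ.measurable hψM)) h2
    have h4 := hcont ψ hψ
    linarith
  have hlim : Tendsto (fun ε : ℝ => ε + (c + Real.log (∫ x, Real.exp (φ x) ∂ν + Real.exp M * ε)))
      (nhdsWithin 0 (Set.Ioi 0)) (nhds (c + Real.log (∫ x, Real.exp (φ x) ∂ν))) := by
    have hc : ContinuousAt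
        (fun ε : ℝ => ε + (c + Real.log (∫ x, Real.exp (φ x) ∂ν + Real.exp M * ε))) 0 := by
      refine continuousAt_id.add (continuousAt_const.add (ContinuousAt.log (by fun_prop) ?_))
      simpa using hposφ.ne'
    have := hc.tendsto.mono_left (nhdsWithin_le_nhds (s := Set.Ioi 0))
    simpa using this
  exact ge_of_tendsto hlim (eventually_nhdsWithin_of_forall fun ε hε => key ε hε)

/-- The hard half of the Donsker-Varadhan variational formula, for bounded measurable functions. -/
theorem relEnt_le_of_forall_bounded {X : Type*} [MeasurableSpace X] {μ ν : Measure X}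
    [IsProbabilityMeasure μ] [IsProbabilityMeasure ν] {c : ℝ}
    (h : ∀ φ : X → ℝ, Measurable φ → (∃ M, ∀ x, |φ x| ≤ M) →
      ∫ x, φ x ∂μ ≤ c + Real.log (∫ x, Real.exp (φ x) ∂ν)) :
    relEnt μ ν ≤ (c : EReal) := by
  have hac : μ ≪ ν := by
    refine Measure.AbsolutelyContinuous.mk fun s hs hνs => ?_
    by_contra hμs
    have hpos : 0 < μ.real s := ENNReal.toReal_pos hμs (measure_ne_top _ _)
    have key : ∀ t : ℝ, t * μ.real s ≤ c := by
      intro t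
      have h1 := h (s.indicator fun _ => t) (measurable_const.indicator hs) ⟨|t|, fun x => by
        by_cases hx : x ∈ s <;> simp [hx]⟩
      have h2 : ∫ x, Real.exp (s.indicator (fun _ => t) x) ∂ν = 1 := by
        have : (fun x => Real.exp (s.indicator (fun _ => t) x)) =ᵐ[ν] fun _ => 1 := by
          have : ∀ᵐ x ∂ν, x ∉ s := measure_eq_zero_iff_ae_notMem.1 hνs
          filter_upwards [this] with x hx
          simp [hx]
        rw [integral_congr_ae this]
        simp
      rw [integral_indicator_const _ hs, h2, Real.log_one, add_zero, smul_eq_mul, mul_comm] at h1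
      exact h1
    have := key ((c + 1) / μ.real s)
    rw [div_mul_cancel₀ _ hpos.ne'] at this
    linarith
  set f : X → ℝ := fun x => (μ.rnDeriv ν x).toReal with hf
  have hfm : Measurable f := (Measure.measurable_rnDeriv μ ν).ennreal_toReal
  have hf0 : ∀ x, 0 ≤ f x := fun x => ENNReal.toReal_nonneg
  have hfint : Integrable f ν := Measure.integrable_toReal_rnDeriv
  have hf1 : ∫ x, f x ∂ν = 1 := by
    rw [hf, Measure.integral_toReal_rnDeriv hac, probReal_univ]
  have hfpos : ∀ᵐ x ∂μ, 0 < f x := by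
    filter_upwards [Measure.rnDeriv_pos hac, hac.ae_le (Measure.rnDeriv_lt_top μ ν)] with x h1 h2
      using ENNReal.toReal_pos h1.ne' h2.ne
  -- truncations of the log-density
  set φ : ℕ → X → ℝ := fun N x => Real.log (min (max (f x) (Real.exp (-N))) (Real.exp N)) with hφ
  have hφm : ∀ N, Measurable (φ N) := fun N =>
    Real.measurable_log.comp ((hfm.max measurable_const).min measurable_const)
  have harg : ∀ (N : ℕ) x, 0 < min (max (f x) (Real.exp (-N))) (Real.exp N) := fun N x =>
    lt_min (lt_max_of_lt_right (Real.exp_pos _)) (Real.exp_pos _)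
  have hφb : ∀ N x, |φ N x| ≤ N := fun N x => by
    rw [abs_le]
    constructor
    · rw [Real.le_log_iff_exp_le (harg N x)]
      refine le_min (le_max_right _ _) (Real.exp_le_exp.2 ?_)
      have : (0 : ℝ) ≤ N := Nat.cast_nonneg N
      linarith
    · rw [Real.log_le_iff_le_exp (harg N x)]
      exact min_le_right _ _
  have hφint : ∀ N, Integrable (φ N) μ := fun N =>
    Integrable.of_bound (hφm N).aestronglyMeasurable N (ae_of_all _ (hφb N))
  have hφexp : ∀ N : ℕ, ∫ x, Real.exp (φ N x) ∂ν ≤ 1 + Real.exp (-N) := fun N => by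
    have : ∫ x, Real.exp (φ N x) ∂ν ≤ ∫ x, (f x + Real.exp (-N)) ∂ν := by
      refine integral_mono_of_nonneg (ae_of_all _ fun x => (Real.exp_pos _).le)
        (hfint.add (integrable_const _)) (ae_of_all _ fun x => ?_)
      simp only [hφ]
      rw [Real.exp_log (harg N x)]
      refine (min_le_left _ _).trans (max_le ?_ ?_)
      · linarith [Real.exp_pos (-(N : ℝ))]
      · linarith [hf0 x]
    rw [integral_add hfint (integrable_const _), hf1] at this
    simpa using this
  have hφc : ∀ N : ℕ, ∫ x, φ N x ∂μ ≤ c + Real.exp (-N) := fun N => by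
    have hi : Integrable (fun x => Real.exp (φ N x)) ν :=
      Integrable.of_bound (Real.measurable_exp.comp (hφm N)).aestronglyMeasurable (Real.exp N)
        (ae_of_all _ fun x => by
          rw [Real.norm_eq_abs, abs_of_pos (Real.exp_pos _)]
          exact Real.exp_le_exp.2 (le_of_abs_le (hφb N x)))
    have h1 := h (φ N) (hφm N) ⟨N, hφb N⟩
    have h2 := Real.log_le_log (integral_exp_pos hi) (hφexp N)
    have h3 : Real.log (1 + Real.exp (-N)) ≤ Real.exp (-N) := by
      have := Real.log_le_sub_one_of_pos (x := 1 + Real.exp (-N)) (by positivity)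
      linarith
    linarith
  -- the negative part of the log-density
  set w : X → ℝ := fun x => max (-Real.log (f x)) 0 with hw
  have hwm : Measurable w := (Real.measurable_log.comp hfm).neg.max measurable_const
  have hw0 : ∀ x, 0 ≤ w x := fun x => le_max_right _ _
  have hwint : Integrable w μ := by
    rw [← integrable_rnDeriv_smul_iff hac]
    refine Integrable.of_bound (hfm.mul hwm).aestronglyMeasurable 1 (ae_of_all _ fun x => ?_)
    change |f x * w x| ≤ 1
    rw [abs_of_nonneg (mul_nonneg (hf0 x) (hw0 x))]
    rcases (hf0 x).eq_or_lt with h0 | h0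
    · simp [← h0]
    · have h1 : w x ≤ (f x)⁻¹ := by
        refine max_le ?_ (inv_nonneg.2 h0.le)
        rw [← Real.log_inv]
        linarith [Real.log_le_sub_one_of_pos (inv_pos.2 h0)]
      calc f x * w x ≤ f x * (f x)⁻¹ := mul_le_mul_of_nonneg_left h1 h0.le
        _ = 1 := mul_inv_cancel₀ h0.ne'
  have hφw : ∀ N, ∀ᵐ x ∂μ, 0 ≤ φ N x + w x := fun N => by
    filter_upwards [hfpos] with x hx
    have h1 : min (Real.log (f x)) 0 ≤ φ N x := by
      rw [Real.le_log_iff_exp_le (harg N x)]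
      refine le_min (le_max_of_le_left ?_) ?_
      · calc Real.exp (min (Real.log (f x)) 0) ≤ Real.exp (Real.log (f x)) :=
            Real.exp_le_exp.2 (min_le_left _ _)
          _ = f x := Real.exp_log hx
      · refine Real.exp_le_exp.2 ((min_le_right _ _).trans (Nat.cast_nonneg N))
    have h2 : w x = -min (Real.log (f x)) 0 := by
      simp only [hw]
      rw [← max_neg_neg, neg_zero]
    linarith
  have hlim : ∀ᵐ x ∂μ, Tendsto (fun N => φ N x) atTop (nhds (Real.log (f x))) := by
    filter_upwards [hfpos] with x hx
    refine tendsto_const_nhds.congr' ?_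
    obtain ⟨N₀, hN₀⟩ := exists_nat_ge |Real.log (f x)|
    filter_upwards [eventually_ge_atTop N₀] with N hN
    have hN' : |Real.log (f x)| ≤ N := hN₀.trans (Nat.cast_le.2 hN)
    have h1 : Real.exp (-N) ≤ f x := by
      rw [← Real.le_log_iff_exp_le hx]
      exact neg_le_of_abs_le hN'
    have h2 : f x ≤ Real.exp N := by
      rw [← Real.log_le_iff_le_exp hx]
      exact le_of_abs_le hN'
    simp only [hφ]
    rw [max_eq_left h1, min_eq_left h2]
  set W := ∫ x, w x ∂μ with hW
  have hb : ∀ N : ℕ, ∫⁻ x, ENNReal.ofReal (φ N x + w x) ∂μ ≤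
      ENNReal.ofReal (c + Real.exp (-N) + W) := fun N => by
    have hi : Integrable (fun x => φ N x + w x) μ := (hφint N).add hwint
    rw [← ofReal_integral_eq_lintegral_ofReal hi (hφw N),
      integral_add (hφint N) hwint]
    exact ENNReal.ofReal_le_ofReal (by linarith [hφc N])
  have hexp0 : Tendsto (fun N : ℕ => Real.exp (-N)) atTop (nhds 0) :=
    Real.tendsto_exp_neg_atTop_nhds_zero.comp tendsto_natCast_atTop_atTop
  have hcW : Tendsto (fun N : ℕ => c + Real.exp (-N) + W) atTop (nhds (c + W)) := by
    simpa using (hexp0.const_add c).add_const W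
  have hcW0 : 0 ≤ c + W := by
    refine ge_of_tendsto' hcW fun N => ?_
    have h1 : 0 ≤ ∫ x, (φ N x + w x) ∂μ := integral_nonneg_of_ae (hφw N)
    rw [integral_add (hφint N) hwint] at h1
    linarith [hφc N]
  have hfatou : ∫⁻ x, ENNReal.ofReal (Real.log (f x) + w x) ∂μ ≤ ENNReal.ofReal (c + W) := by
    calc ∫⁻ x, ENNReal.ofReal (Real.log (f x) + w x) ∂μ
        = ∫⁻ x, liminf (fun N => ENNReal.ofReal (φ N x + w x)) atTop ∂μ := by
          refine lintegral_congr_ae ?_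
          filter_upwards [hlim] with x hx
          exact (ENNReal.tendsto_ofReal (hx.add_const (w x))).liminf_eq.symm
      _ ≤ liminf (fun N => ∫⁻ x, ENNReal.ofReal (φ N x + w x) ∂μ) atTop :=
          lintegral_liminf_le fun N => ((hφm N).add hwm).ennreal_ofReal
      _ ≤ liminf (fun N : ℕ => ENNReal.ofReal (c + Real.exp (-N) + W)) atTop :=
          liminf_le_liminf (Eventually.of_forall hb)
      _ = ENNReal.ofReal (c + W) := (ENNReal.tendsto_ofReal hcW).liminf_eq
  have hnn : ∀ x, 0 ≤ Real.log (f x) + w x := fun x => by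
    have : -Real.log (f x) ≤ w x := le_max_left _ _
    linarith
  have hsm : AEStronglyMeasurable (fun x => Real.log (f x) + w x) μ :=
    ((Real.measurable_log.comp hfm).add hwm).aestronglyMeasurable
  have hsint : Integrable (fun x => Real.log (f x) + w x) μ :=
    (lintegral_ofReal_ne_top_iff_integrable hsm (ae_of_all _ hnn)).1
      (hfatou.trans_lt ENNReal.ofReal_lt_top).ne
  have hlint : Integrable (fun x => Real.log (f x)) μ := by
    refine (hsint.sub hwint).congr (ae_of_all _ fun x => ?_)
    simp
  have hfinal : ∫ x, Real.log (f x) ∂μ ≤ c := by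
    rw [← ofReal_integral_eq_lintegral_ofReal hsint (ae_of_all _ hnn),
      ENNReal.ofReal_le_ofReal_iff hcW0, integral_add hlint hwint] at hfatou
    linarith
  unfold relEnt
  rw [if_pos ⟨hac, hlint⟩]
  exact EReal.coe_le_coe_iff.2 hfinal
/-! ### The metric `dOmega` and Hölder functions -/

theorem dOmega_term_nonneg (x y : ℕ → A) (n : ℕ) :
    0 ≤ (1 / 2 : ℝ) ^ (n + 1) * (dist (x n) (y n) / (1 + dist (x n) (y n))) := by positivity

theorem dOmega_term_le (x y : ℕ → A) (n : ℕ) :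
    (1 / 2 : ℝ) ^ (n + 1) * (dist (x n) (y n) / (1 + dist (x n) (y n))) ≤ (1 / 2 : ℝ) ^ (n + 1) := by
  refine mul_le_of_le_one_right (by positivity) ?_
  rw [div_le_one (by positivity)]
  linarith [dist_nonneg (x := x n) (y := y n)]

theorem summable_half_pow_succ : Summable fun n : ℕ => (1 / 2 : ℝ) ^ (n + 1) :=
  (summable_nat_add_iff 1).2 summable_geometric_two

theorem summable_dOmega_term (x y : ℕ → A) :
    Summable fun n => (1 / 2 : ℝ) ^ (n + 1) * (dist (x n) (y n) / (1 + dist (x n) (y n))) :=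
  summable_half_pow_succ.of_nonneg_of_le (dOmega_term_nonneg x y) (dOmega_term_le x y)

theorem dOmega_nonneg (x y : ℕ → A) : 0 ≤ dOmega x y := tsum_nonneg (dOmega_term_nonneg x y)

theorem dOmega_self (x : ℕ → A) : dOmega x x = 0 := by simp [dOmega]

theorem dOmega_le_of_agree {x y : ℕ → A} {k : ℕ} (h : ∀ i < k, x i = y i) :
    dOmega x y ≤ (1 / 2 : ℝ) ^ k := by
  have h0 : ∑ i ∈ Finset.range k,
      (1 / 2 : ℝ) ^ (i + 1) * (dist (x i) (y i) / (1 + dist (x i) (y i))) = 0 :=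
    Finset.sum_eq_zero fun i hi => by simp [h i (Finset.mem_range.1 hi)]
  have h1 : ∑' n : ℕ, (1 / 2 : ℝ) ^ (n + k + 1) = (1 / 2 : ℝ) ^ k := by
    simp_rw [pow_add, pow_one]
    rw [tsum_mul_right, tsum_mul_right, tsum_geometric_two]
    ring
  rw [dOmega, ← (summable_dOmega_term x y).sum_add_tsum_nat_add k, h0, zero_add, ← h1]
  exact ((summable_nat_add_iff k).2 (summable_dOmega_term x y)).tsum_le_tsum
    (fun n => dOmega_term_le x y (n + k)) ((summable_nat_add_iff k).2 summable_half_pow_succ)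

theorem dOmega_le_one (x y : ℕ → A) : dOmega x y ≤ 1 := by
  simpa using dOmega_le_of_agree (x := x) (y := y) (k := 0) (by simp)

theorem dist_apply_le_dOmega (x y : ℕ → A) (n : ℕ) :
    dist (x n) (y n) ≤ 2 ^ (n + 1) * (1 + Metric.diam (Set.univ : Set A)) * dOmega x y := by
  have h1 : (1 / 2 : ℝ) ^ (n + 1) * (dist (x n) (y n) / (1 + dist (x n) (y n))) ≤ dOmega x y :=
    (summable_dOmega_term x y).le_tsum n fun i _ => dOmega_term_nonneg x y i
  have h2 : dist (x n) (y n) ≤ Metric.diam (Set.univ : Set A) :=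
    Metric.dist_le_diam_of_mem isCompact_univ.isBounded (Set.mem_univ _) (Set.mem_univ _)
  have hd := dist_nonneg (x := x n) (y := y n)
  have hO := dOmega_nonneg x y
  have h3 : dist (x n) (y n) ≤ 2 ^ (n + 1) * (1 + dist (x n) (y n)) * dOmega x y := by
    calc dist (x n) (y n) = 2 ^ (n + 1) * (1 + dist (x n) (y n)) *
          ((1 / 2 : ℝ) ^ (n + 1) * (dist (x n) (y n) / (1 + dist (x n) (y n)))) := by
          rw [one_div, inv_pow]
          field_simp
      _ ≤ _ := by gcongr
  exact h3.trans (by gcongr)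

theorem continuous_dOmega_left (y : ℕ → A) : Continuous fun x : ℕ → A => dOmega x y := by
  refine continuous_tsum (fun n => ?_) summable_half_pow_succ fun n x => ?_
  · refine continuous_const.mul (Continuous.div (by fun_prop) (by fun_prop) fun x => ?_)
    positivity
  · rw [Real.norm_of_nonneg (dOmega_term_nonneg x y n)]
    exact dOmega_term_le x y n

theorem IsHolder.continuous {α : ℝ} (hα : 0 < α) {f : (ℕ → A) → ℝ} (hf : IsHolder α f) :
    Continuous f := by
  obtain ⟨C, -, hC⟩ := hf
  refine continuous_iff_continuousAt.2 fun y => ?_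
  rw [ContinuousAt, tendsto_iff_dist_tendsto_zero]
  have h : Tendsto (fun x => C * dOmega x y ^ α) (nhds y) (nhds 0) := by
    have := ((continuous_dOmega_left y).tendsto y).rpow_const (p := α) (Or.inr hα.le)
    simpa [dOmega_self, Real.zero_rpow hα.ne'] using this.const_mul C
  exact squeeze_zero (fun _ => dist_nonneg) (fun x => by rw [Real.dist_eq]; exact hC x y) h

theorem exists_abs_le_of_continuous {X : Type*} [TopologicalSpace X] [CompactSpace X] {f : X → ℝ}
    (hf : Continuous f) : ∃ M, ∀ x, |f x| ≤ M := by
  obtain ⟨M, hM⟩ := isCompact_univ.exists_bound_of_continuousOn hf.continuousOn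
  exact ⟨M, fun x => hM x (Set.mem_univ x)⟩

theorem integrable_of_continuous {X : Type*} [TopologicalSpace X] [CompactSpace X]
    [MeasurableSpace X] [OpensMeasurableSpace X] (ρ : Measure X) [IsFiniteMeasure ρ] {f : X → ℝ}
    (hf : Continuous f) : Integrable f ρ := by
  obtain ⟨M, hM⟩ := exists_abs_le_of_continuous hf
  exact Integrable.of_bound hf.measurable.aestronglyMeasurable M (ae_of_all _ hM)

/-- Lipschitz functions of finitely many coordinates are Hölder. -/
theorem isHolder_comp_proj {α : ℝ} (hα : α ≤ 1) {n : ℕ} {φ : (Fin n → A) → ℝ} {K : NNReal}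
    (hφ : LipschitzWith K φ) : IsHolder α fun x => φ (proj n x) := by
  refine ⟨K * (2 ^ (n + 1) * (1 + Metric.diam (Set.univ : Set A))), ?_, fun x y => ?_⟩
  · have := Metric.diam_nonneg (s := (Set.univ : Set A))
    positivity
  · have hD := Metric.diam_nonneg (s := (Set.univ : Set A))
    have hO := dOmega_nonneg x y
    have h1 : dist (proj n x) (proj n y) ≤
        2 ^ (n + 1) * (1 + Metric.diam (Set.univ : Set A)) * dOmega x y := by
      refine (dist_pi_le_iff (by positivity)).2 fun i => ?_
      refine (dist_apply_le_dOmega x y i).trans ?_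
      gcongr
      · norm_num
      · exact i.2.le
    have h2 : dOmega x y ≤ dOmega x y ^ α := by
      rcases hO.eq_or_lt with h0 | h0
      · rw [← h0]
        exact Real.rpow_nonneg le_rfl _
      · simpa using Real.rpow_le_rpow_of_exponent_ge h0 (dOmega_le_one x y) hα
    calc |φ (proj n x) - φ (proj n y)| ≤ K * dist (proj n x) (proj n y) := by
          rw [← Real.dist_eq]
          exact hφ.dist_le_mul _ _
      _ ≤ K * (2 ^ (n + 1) * (1 + Metric.diam (Set.univ : Set A)) * dOmega x y ^ α) := by
          refine mul_le_mul_of_nonneg_left (h1.trans ?_) K.2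
          gcongr
      _ = _ := by ring

theorem IsHolder.const_mul {α : ℝ} {f : (ℕ → A) → ℝ} (hf : IsHolder α f) (c : ℝ) :
    IsHolder α fun x => c * f x := by
  obtain ⟨C, hC0, hC⟩ := hf
  refine ⟨|c| * C, by positivity, fun x y => ?_⟩
  rw [← mul_sub, abs_mul, mul_assoc]
  exact mul_le_mul_of_nonneg_left (hC x y) (abs_nonneg c)

/-! ### Birkhoff sums -/

theorem continuous_shift : Continuous (shift : (ℕ → A) → ℕ → A) :=
  continuous_pi fun n => continuous_apply (n + 1)

theorem shift_iterate_apply (n : ℕ) (x : ℕ → A) (i : ℕ) : shift^[n] x i = x (i + n) := by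
  induction n generalizing x with
  | zero => rfl
  | succ n ih =>
    rw [Function.iterate_succ_apply, ih]
    simp only [shift]
    congr 1

theorem cons_zero_shift (x : ℕ → A) : cons (x 0) (shift x) = x := by
  funext n
  cases n <;> rfl

theorem shift_cons (a : A) (x : ℕ → A) : shift (cons a x) = x := rfl

theorem continuous_cons : Continuous fun q : A × (ℕ → A) => cons q.1 q.2 := by
  refine continuous_pi fun n => ?_
  cases n with
  | zero => exact continuous_fst
  | succ n => exact (continuous_apply n).comp continuous_snd

theorem continuous_proj (n : ℕ) : Continuous (proj n : (ℕ → A) → Fin n → A) :=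
  continuous_pi fun i => continuous_apply (i : ℕ)

theorem continuous_birkhoff {g : (ℕ → A) → ℝ} (hg : Continuous g) (n : ℕ) :
    Continuous (birkhoff n g) :=
  continuous_finsetSum _ fun i _ => hg.comp (continuous_shift.iterate i)

theorem birkhoff_succ (n : ℕ) (g : (ℕ → A) → ℝ) (x : ℕ → A) :
    birkhoff (n + 1) g x = birkhoff n g (shift x) + g x := by
  simp [birkhoff, Finset.sum_range_succ', Function.iterate_succ_apply]

/-- Birkhoff sums of length `n` of a Hölder function depend, up to a bounded error, only on the
first `n` coordinates. -/
theorem IsHolder.exists_abs_birkhoff_sub_le {α : ℝ} (hα : 0 < α) {g : (ℕ → A) → ℝ}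
    (hg : IsHolder α g) : ∃ D, ∀ (n : ℕ) (x y : ℕ → A), (∀ i < n, x i = y i) →
      |birkhoff n g x - birkhoff n g y| ≤ D := by
  obtain ⟨C, hC0, hC⟩ := hg
  set r : ℝ := (1 / 2 : ℝ) ^ α with hr
  have hr0 : 0 ≤ r := by positivity
  have hr1 : r < 1 := Real.rpow_lt_one (by norm_num) (by norm_num) hα
  refine ⟨C * (1 - r)⁻¹, fun n x y hxy => ?_⟩
  have hterm : ∀ i ∈ Finset.range n, |g (shift^[i] x) - g (shift^[i] y)| ≤ C * r ^ (n - 1 - i) := by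
    intro i hi
    have hi := Finset.mem_range.1 hi
    refine (hC _ _).trans (mul_le_mul_of_nonneg_left ?_ hC0)
    have h1 : dOmega (shift^[i] x) (shift^[i] y) ≤ (1 / 2 : ℝ) ^ (n - 1 - i) := by
      refine dOmega_le_of_agree fun j hj => ?_
      rw [shift_iterate_apply, shift_iterate_apply]
      exact hxy _ (by omega)
    calc dOmega (shift^[i] x) (shift^[i] y) ^ α ≤ ((1 / 2 : ℝ) ^ (n - 1 - i)) ^ α :=
          Real.rpow_le_rpow (dOmega_nonneg _ _) h1 hα.le
      _ = r ^ (n - 1 - i) := by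
          rw [hr, ← Real.rpow_natCast, ← Real.rpow_natCast, ← Real.rpow_mul (by norm_num),
            ← Real.rpow_mul (by norm_num), mul_comm]
  calc |birkhoff n g x - birkhoff n g y|
      = |∑ i ∈ Finset.range n, (g (shift^[i] x) - g (shift^[i] y))| := by
        rw [birkhoff, birkhoff, Finset.sum_sub_distrib]
    _ ≤ ∑ i ∈ Finset.range n, |g (shift^[i] x) - g (shift^[i] y)| := Finset.abs_sum_le_sum_abs _ _
    _ ≤ ∑ i ∈ Finset.range n, C * r ^ (n - 1 - i) := Finset.sum_le_sum hterm
    _ = C * ∑ i ∈ Finset.range n, r ^ i := by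
        rw [← Finset.mul_sum, Finset.sum_range_reflect (fun i => r ^ i)]
    _ ≤ C * (1 - r)⁻¹ := by
        rw [← tsum_geometric_of_lt_one hr0 hr1]
        exact mul_le_mul_of_nonneg_left
          ((summable_geometric_of_lt_one hr0 hr1).sum_le_tsum _ fun i _ => by positivity) hC0

/-! ### The product measure -/

section Product

variable (p : Measure A) [IsProbabilityMeasure p]

theorem map_shift_infinitePi :
    (Measure.infinitePi fun _ : ℕ => p).map shift = Measure.infinitePi fun _ : ℕ => p :=
  Measure.map_infinitePi_infinitePi_of_inj (P := fun _ : ℕ => p) (add_left_injective 1)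

theorem integral_comp_shift_iterate {μ : Measure (ℕ → A)} (hinv : μ.map shift = μ)
    {F : (ℕ → A) → ℝ} (hF : Continuous F) (n : ℕ) :
    ∫ x, F (shift^[n] x) ∂μ = ∫ x, F x ∂μ := by
  have hmp : MeasurePreserving shift^[n] μ μ :=
    MeasurePreserving.iterate ⟨continuous_shift.measurable, hinv⟩ n
  conv_rhs => rw [← hmp.map_eq]
  rw [integral_map hmp.measurable.aemeasurable hF.measurable.aestronglyMeasurable]

theorem map_proj_infinitePi (n : ℕ) :
    (Measure.infinitePi fun _ : ℕ => p).map (proj n) = Measure.pi fun _ : Fin n => p := by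
  rw [← Measure.infinitePi_eq_pi]
  exact Measure.map_infinitePi_infinitePi_of_inj (P := fun _ : ℕ => p) Fin.val_injective

theorem indepFun_proj_shift (n : ℕ) :
    ProbabilityTheory.IndepFun (proj n) (shift^[n]) (Measure.infinitePi fun _ : ℕ => p) := by
  have h := ProbabilityTheory.iIndepFun_infinitePi (P := fun _ : ℕ => p)
    (X := fun _ a => a) fun _ => measurable_id
  have hdisj : Disjoint {i : ℕ | i < n} {i : ℕ | n ≤ i} :=
    Set.disjoint_left.2 fun i (h1 : i < n) (h2 : n ≤ i) => absurd h1 h2.not_gt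
  have hind := ProbabilityTheory.indep_iSup_of_disjoint
    (fun i => (measurable_pi_apply i).comap_le) h hdisj
  refine ProbabilityTheory.indep_of_indep_of_le_left
    (ProbabilityTheory.indep_of_indep_of_le_right hind ?_) ?_
  · rw [MeasurableSpace.pi, MeasurableSpace.comap_iSup]
    refine iSup_le fun i => ?_
    have : (fun b : ℕ → A => b i) ∘ shift^[n] = fun x : ℕ → A => x (i + n) :=
      funext fun x => shift_iterate_apply n x i
    rw [MeasurableSpace.comap_comp, this]
    exact le_iSup₂_of_le (i + n) (Nat.le_add_left n i) le_rfl
  · rw [MeasurableSpace.pi, MeasurableSpace.comap_iSup]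
    refine iSup_le fun i => ?_
    rw [MeasurableSpace.comap_comp]
    exact le_iSup₂_of_le (i : ℕ) i.2 le_rfl

theorem integral_mul_proj_shift {n : ℕ} {F : (Fin n → A) → ℝ} {G : (ℕ → A) → ℝ}
    (hF : Continuous F) (hG : Continuous G) :
    ∫ x, F (proj n x) * G (shift^[n] x) ∂(Measure.infinitePi fun _ : ℕ => p) =
      (∫ a, F a ∂(Measure.pi fun _ : Fin n => p)) *
        ∫ x, G x ∂(Measure.infinitePi fun _ : ℕ => p) := by
  have hind := (indepFun_proj_shift p n).comp hF.measurable hG.measurable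
  have h1 := hind.integral_fun_mul_eq_mul_integral
    (hF.comp (continuous_proj n)).measurable.aestronglyMeasurable
    (hG.comp (continuous_shift.iterate n)).measurable.aestronglyMeasurable
  simp only [Function.comp_apply] at h1
  rw [h1, ← map_proj_infinitePi p n,
    integral_map (continuous_proj n).measurable.aemeasurable hF.measurable.aestronglyMeasurable]
  rw [integral_comp_shift_iterate (map_shift_infinitePi p) hG]

theorem map_apply_zero_shift :
    (Measure.infinitePi fun _ : ℕ => p).map (fun x => (x 0, shift x)) =
      p.prod (Measure.infinitePi fun _ : ℕ => p) := by
  have h0 : Measurable fun a : Fin 1 → A => a 0 := measurable_pi_apply 0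
  have h := (indepFun_proj_shift p 1).comp h0 measurable_id
  have h' : ProbabilityTheory.IndepFun (fun x : ℕ → A => x 0) shift
    (Measure.infinitePi fun _ : ℕ => p) := h
  rw [(ProbabilityTheory.indepFun_iff_map_prod_eq_prod_map_map
    (measurable_pi_apply 0).aemeasurable continuous_shift.measurable.aemeasurable).1 h',
    map_shift_infinitePi]
  congr 1
  exact Measure.infinitePi_map_eval (fun _ : ℕ => p) 0

theorem integral_infinitePi_eq_integral_cons {F : (ℕ → A) → ℝ} (hF : Continuous F) :
    ∫ x, F x ∂(Measure.infinitePi fun _ : ℕ => p) =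
      ∫ y, ∫ a, F (cons a y) ∂p ∂(Measure.infinitePi fun _ : ℕ => p) := by
  have hc : Continuous fun q : A × (ℕ → A) => F (cons q.1 q.2) := hF.comp continuous_cons
  have h1 : ∫ x, F x ∂(Measure.infinitePi fun _ : ℕ => p) =
      ∫ q, F (cons q.1 q.2) ∂(p.prod (Measure.infinitePi fun _ : ℕ => p)) := by
    rw [← map_apply_zero_shift, integral_map]
    · simp only [cons_zero_shift]
    · exact ((measurable_pi_apply 0).prodMk continuous_shift.measurable).aemeasurable
    · exact hc.measurable.aestronglyMeasurable
  rw [h1, integral_prod_symm _ (integrable_of_continuous _ hc)]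

/-- Integrated form of the iterated eigenfunction equation `L_g^n h = λ^n h`. -/
theorem integral_exp_birkhoff_mul_eigenfunction {g h : (ℕ → A) → ℝ} {c : ℝ} (hg : Continuous g)
    (hh : Continuous h) (heig : ∀ x, ruelle p g h x = c * h x) (n : ℕ) :
    ∫ x, Real.exp (birkhoff n g x) * h x ∂(Measure.infinitePi fun _ : ℕ => p) =
      c ^ n * ∫ x, h x ∂(Measure.infinitePi fun _ : ℕ => p) := by
  induction n with
  | zero => simp [birkhoff]
  | succ n ih =>
    have hb := continuous_birkhoff hg
    have hc : Continuous fun x => Real.exp (birkhoff (n + 1) g x) * h x :=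
      (Real.continuous_exp.comp (hb (n + 1))).mul hh
    rw [integral_infinitePi_eq_integral_cons p hc,
      pow_succ', mul_assoc, ← ih, ← integral_const_mul]
    refine integral_congr_ae (ae_of_all _ fun y => ?_)
    have : ∀ a, Real.exp (birkhoff (n + 1) g (cons a y)) * h (cons a y) =
        Real.exp (birkhoff n g y) * (Real.exp (g (cons a y)) * h (cons a y)) := fun a => by
      rw [birkhoff_succ, shift_cons, Real.exp_add, mul_assoc]
    simp only [this]
    rw [integral_const_mul]
    have h2 := heig y
    rw [ruelle] at h2
    rw [h2]
    ring

/-- The eigenvalue of a positive eigenfunction is the exponential growth rate of the partition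
functions `∫ exp (S_n g)`. -/
theorem exists_integral_exp_birkhoff_bounds [Nonempty A] {g h : (ℕ → A) → ℝ} {c : ℝ}
    (hg : Continuous g) (hh : Continuous h) (hpos : ∀ x, 0 < h x) (hc : 0 < c)
    (heig : ∀ x, ruelle p g h x = c * h x) :
    ∃ K : ℝ, 0 < K ∧ ∀ n : ℕ,
      ∫ x, Real.exp (birkhoff n g x) ∂(Measure.infinitePi fun _ : ℕ => p) ≤ K * c ^ n ∧
      c ^ n ≤ K * ∫ x, Real.exp (birkhoff n g x) ∂(Measure.infinitePi fun _ : ℕ => p) := by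
  set P := Measure.infinitePi fun _ : ℕ => p with hP
  obtain ⟨x₀, -, hx₀⟩ := isCompact_univ.exists_isMinOn Set.univ_nonempty hh.continuousOn
  obtain ⟨x₁, -, hx₁⟩ := isCompact_univ.exists_isMaxOn Set.univ_nonempty hh.continuousOn
  have hmin : ∀ x, h x₀ ≤ h x := fun x => hx₀ (Set.mem_univ x)
  have hmax : ∀ x, h x ≤ h x₁ := fun x => hx₁ (Set.mem_univ x)
  have h0 := hpos x₀
  have h1 := hpos x₁
  have hhi := integrable_of_continuous P hh
  have hI0 : h x₀ ≤ ∫ x, h x ∂P := by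
    simpa using integral_mono (integrable_const _) hhi hmin
  have hI1 : ∫ x, h x ∂P ≤ h x₁ := by
    simpa using integral_mono hhi (integrable_const _) hmax
  refine ⟨h x₁ / h x₀, by positivity, fun n => ?_⟩
  have hE : Continuous fun x => Real.exp (birkhoff n g x) :=
    Real.continuous_exp.comp (continuous_birkhoff hg n)
  have hEi := integrable_of_continuous P hE
  have hEh := integrable_of_continuous P (hE.mul hh)
  have hkey := integral_exp_birkhoff_mul_eigenfunction p hg hh heig n
  rw [← hP] at hkey
  have hcn : 0 < c ^ n := pow_pos hc n
  constructor
  · rw [div_mul_eq_mul_div, le_div_iff₀ h0]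
    calc (∫ x, Real.exp (birkhoff n g x) ∂P) * h x₀
        = ∫ x, Real.exp (birkhoff n g x) * h x₀ ∂P := (integral_mul_const _ _).symm
      _ ≤ ∫ x, Real.exp (birkhoff n g x) * h x ∂P :=
          integral_mono (hEi.mul_const _) hEh fun x =>
            mul_le_mul_of_nonneg_left (hmin x) (Real.exp_pos _).le
      _ = c ^ n * ∫ x, h x ∂P := hkey
      _ ≤ h x₁ * c ^ n := by rw [mul_comm]; gcongr
  · rw [div_mul_eq_mul_div, le_div_iff₀ h0]
    calc c ^ n * h x₀ ≤ c ^ n * ∫ x, h x ∂P := by gcongr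
      _ = ∫ x, Real.exp (birkhoff n g x) * h x ∂P := hkey.symm
      _ ≤ ∫ x, Real.exp (birkhoff n g x) * h x₁ ∂P :=
          integral_mono hEh (hEi.mul_const _) fun x =>
            mul_le_mul_of_nonneg_left (hmax x) (Real.exp_pos _).le
      _ = h x₁ * ∫ x, Real.exp (birkhoff n g x) ∂P := by rw [integral_mul_const, mul_comm]

/-- Independence of consecutive blocks. -/
theorem integral_exp_sum_blocks {n : ℕ} {φ : (Fin n → A) → ℝ} (hφ : Continuous φ) (k : ℕ) :
    ∫ x, Real.exp (∑ i ∈ Finset.range k, φ (proj n (shift^[n * i] x)))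
        ∂(Measure.infinitePi fun _ : ℕ => p) =
      (∫ a, Real.exp (φ a) ∂(Measure.pi fun _ : Fin n => p)) ^ k := by
  induction k with
  | zero => simp
  | succ k ih =>
    have hG : Continuous fun x : ℕ → A =>
        Real.exp (∑ i ∈ Finset.range k, φ (proj n (shift^[n * i] x))) :=
      Real.continuous_exp.comp (continuous_finsetSum _ fun i _ =>
        hφ.comp ((continuous_proj n).comp (continuous_shift.iterate _)))
    have hs : ∀ x : ℕ → A, Real.exp (∑ i ∈ Finset.range (k + 1), φ (proj n (shift^[n * i] x))) =
        Real.exp (φ (proj n x)) *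
          Real.exp (∑ i ∈ Finset.range k, φ (proj n (shift^[n * i] (shift^[n] x)))) := fun x => by
      rw [Finset.sum_range_succ', Real.exp_add, mul_comm]
      simp only [mul_zero, Function.iterate_zero, id, mul_add, mul_one,
        Function.iterate_add_apply]
    simp only [hs]
    rw [integral_mul_proj_shift p (F := fun a => Real.exp (φ a)) (Real.continuous_exp.comp hφ) hG,
      ih, pow_succ']

theorem sum_range_mul_eq_sum_sum (f : ℕ → ℝ) (n k : ℕ) :
    ∑ m ∈ Finset.range (n * k), f m =
      ∑ j ∈ Finset.range n, ∑ i ∈ Finset.range k, f (n * i + j) := by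
  induction k with
  | zero => simp
  | succ k ih =>
    simp only [Finset.sum_range_succ, Finset.sum_add_distrib]
    rw [mul_add, mul_one, Finset.sum_range_add, ih]

/-- The partition functions of the averaged potential `x ↦ φ (x₁, …, xₙ) / n` are at most `1` if
`∫ exp φ = 1`. -/
theorem integral_exp_birkhoff_average_le_one {n : ℕ} (hn : 0 < n) {φ : (Fin n → A) → ℝ}
    (hφ : Continuous φ) (h1 : ∫ a, Real.exp (φ a) ∂(Measure.pi fun _ : Fin n => p) = 1) (k : ℕ) :
    ∫ x, Real.exp (birkhoff (n * k) (fun x => (n : ℝ)⁻¹ * φ (proj n x)) x)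
      ∂(Measure.infinitePi fun _ : ℕ => p) ≤ 1 := by
  set P := Measure.infinitePi fun _ : ℕ => p with hP
  have hn' : (0 : ℝ) < n := Nat.cast_pos.2 hn
  set ψ : (ℕ → A) → ℝ := fun x => ∑ i ∈ Finset.range k, φ (proj n (shift^[n * i] x)) with hψ
  have hψc : Continuous ψ := continuous_finsetSum _ fun i _ =>
    hφ.comp ((continuous_proj n).comp (continuous_shift.iterate _))
  have hψj : ∀ j, Continuous fun x => Real.exp (ψ (shift^[j] x)) := fun j =>
    Real.continuous_exp.comp (hψc.comp (continuous_shift.iterate j))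
  have hpt : ∀ x, Real.exp (birkhoff (n * k) (fun x => (n : ℝ)⁻¹ * φ (proj n x)) x) ≤
      ∑ j ∈ Finset.range n, (n : ℝ)⁻¹ * Real.exp (ψ (shift^[j] x)) := fun x => by
    have : birkhoff (n * k) (fun x => (n : ℝ)⁻¹ * φ (proj n x)) x =
        ∑ j ∈ Finset.range n, (n : ℝ)⁻¹ • ψ (shift^[j] x) := by
      rw [birkhoff, sum_range_mul_eq_sum_sum]
      refine Finset.sum_congr rfl fun j _ => ?_
      simp only [hψ, smul_eq_mul, Finset.mul_sum, Function.iterate_add_apply]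
    rw [this]
    refine convexOn_exp.map_sum_le (fun _ _ => by positivity) ?_ fun _ _ => Set.mem_univ _
    simp [hn'.ne']
  have hint : ∀ j ∈ Finset.range n,
      Integrable (fun x => (n : ℝ)⁻¹ * Real.exp (ψ (shift^[j] x))) P := fun j _ =>
    (integrable_of_continuous P (hψj j)).const_mul _
  refine (integral_mono_of_nonneg (ae_of_all _ fun x => (Real.exp_pos _).le)
    (integrable_finsetSum _ hint) (ae_of_all _ hpt)).trans ?_
  rw [integral_finsetSum _ hint]
  have hj : ∀ j, ∫ x, (n : ℝ)⁻¹ * Real.exp (ψ (shift^[j] x)) ∂P = (n : ℝ)⁻¹ := fun j => by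
    have h2 : ∫ x, Real.exp (ψ (shift^[j] x)) ∂P = ∫ x, Real.exp (ψ x) ∂P :=
      integral_comp_shift_iterate (map_shift_infinitePi p) (Real.continuous_exp.comp hψc) j
    rw [integral_const_mul, h2, hψ, hP, integral_exp_sum_blocks p hφ k, h1, one_pow, mul_one]
  simp [hj, hn'.ne']

end Product

/-! ### The two inequalities -/

theorem continuous_wordCons (n : ℕ) (y : ℕ → A) : Continuous fun a : Fin n → A => wordCons n a y := by
  refine continuous_pi fun i => ?_
  by_cases h : i < n
  · simpa [wordCons, h] using continuous_apply (⟨i, h⟩ : Fin n)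
  · simpa [wordCons, h] using continuous_const

theorem wordCons_proj_apply {n i : ℕ} (hi : i < n) (x y : ℕ → A) :
    wordCons n (proj n x) y i = x i := by
  simp [wordCons, proj, hi]

theorem integral_birkhoff {μ : Measure (ℕ → A)} [IsProbabilityMeasure μ] (hinv : μ.map shift = μ)
    {g : (ℕ → A) → ℝ} (hg : Continuous g) (n : ℕ) :
    ∫ x, birkhoff n g x ∂μ = n * ∫ x, g x ∂μ := by
  simp only [birkhoff]
  have hi : ∀ i ∈ Finset.range n, Integrable (fun x => g (shift^[i] x)) μ := fun i _ =>
    integrable_of_continuous μ (hg.comp (continuous_shift.iterate i))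
  rw [integral_finsetSum _ hi]
  simp [integral_comp_shift_iterate hinv hg]

theorem exists_relEnt_proj_ge (p : Measure A) [IsProbabilityMeasure p] {α : ℝ} (hα : 0 < α)
    {g h : (ℕ → A) → ℝ} {c : ℝ} (hg : IsHolder α g) (hh : Continuous h) (hpos : ∀ x, 0 < h x)
    (hc : 0 < c) (heig : ∀ x, ruelle p g h x = c * h x)
    (μ : Measure (ℕ → A)) [IsProbabilityMeasure μ] (hinv : μ.map shift = μ) :
    ∃ D : ℝ, ∀ n : ℕ, ((n * (∫ x, g x ∂μ - Real.log c) - D : ℝ) : EReal) ≤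
      relEnt (μ.map (proj n)) (Measure.pi fun _ : Fin n => p) := by
  obtain ⟨y⟩ : Nonempty (ℕ → A) := Measure.nonempty_of_neZero μ
  have : Nonempty A := ⟨y 0⟩
  have hgc := hg.continuous hα
  obtain ⟨D, hD⟩ := hg.exists_abs_birkhoff_sub_le hα
  obtain ⟨K, hK, hKn⟩ := exists_integral_exp_birkhoff_bounds p hgc hh hpos hc heig
  refine ⟨2 * D + Real.log K, fun n => ?_⟩
  set P := Measure.infinitePi fun _ : ℕ => p with hP
  set φ : (Fin n → A) → ℝ := fun a => birkhoff n g (wordCons n a y) with hφdef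
  have hb := continuous_birkhoff hgc n
  have hφ : Continuous φ := hb.comp (continuous_wordCons n y)
  have hclose : ∀ x, |φ (proj n x) - birkhoff n g x| ≤ D := fun x =>
    hD n _ _ fun i hi => wordCons_proj_apply hi x y
  have hproj := (continuous_proj (A := A) n).measurable.aemeasurable (μ := μ)
  have hprojP := (continuous_proj (A := A) n).measurable.aemeasurable (μ := P)
  have : IsProbabilityMeasure (μ.map (proj n)) := Measure.isProbabilityMeasure_map hproj
  have hexp : Continuous fun a => Real.exp (φ a) := Real.continuous_exp.comp hφ
  have hφi : Integrable (fun x => φ (proj n x)) μ :=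
    integrable_of_continuous μ (hφ.comp (continuous_proj n))
  have h1 : n * ∫ x, g x ∂μ - D ≤ ∫ a, φ a ∂(μ.map (proj n)) := by
    rw [integral_map hproj hφ.measurable.aestronglyMeasurable, ← integral_birkhoff hinv hgc]
    have := integral_mono (integrable_of_continuous μ hb) (hφi.add (integrable_const D))
      fun x => by
        have := neg_le_of_abs_le (hclose x)
        change birkhoff n g x ≤ φ (proj n x) + D
        linarith
    have h2 : ∫ x, (φ (proj n x) + D) ∂μ = ∫ x, φ (proj n x) ∂μ + D := by
      rw [integral_add hφi (integrable_const D)]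
      simp
    change _ ≤ ∫ x, (φ (proj n x) + D) ∂μ at this
    linarith
  have h2 : Real.log (∫ a, Real.exp (φ a) ∂(Measure.pi fun _ : Fin n => p)) ≤
      D + Real.log K + n * Real.log c := by
    have hpos' : 0 < ∫ a, Real.exp (φ a) ∂(Measure.pi fun _ : Fin n => p) :=
      integral_exp_pos (integrable_of_continuous _ hexp)
    have hle : ∫ a, Real.exp (φ a) ∂(Measure.pi fun _ : Fin n => p) ≤
        Real.exp D * (K * c ^ n) := by
      rw [← map_proj_infinitePi p n, integral_map hprojP hexp.measurable.aestronglyMeasurable]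
      refine le_trans ?_ (mul_le_mul_of_nonneg_left (hKn n).1 (Real.exp_pos D).le)
      rw [← integral_const_mul]
      refine integral_mono (integrable_of_continuous P (hexp.comp (continuous_proj n)))
        ((integrable_of_continuous P (Real.continuous_exp.comp hb)).const_mul _) fun x => ?_
      dsimp only
      rw [← Real.exp_add]
      have := le_of_abs_le (hclose x)
      exact Real.exp_le_exp.2 (by linarith)
    have := Real.log_le_log hpos' hle
    rwa [Real.log_mul (Real.exp_pos D).ne' (by positivity), Real.log_exp,
      Real.log_mul hK.ne' (by positivity), Real.log_pow, ← add_assoc] at this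
  refine le_trans (EReal.coe_le_coe_iff.2 ?_) (integral_sub_log_integral_exp_le_relEnt _ _
    (integrable_of_continuous _ hφ) (integrable_of_continuous _ hexp))
  linarith

theorem specEnt_le (p : Measure A) [IsProbabilityMeasure p] {α : ℝ} (hα : 0 < α)
    {g h : (ℕ → A) → ℝ} {c : ℝ} (hg : IsHolder α g) (hh : Continuous h) (hpos : ∀ x, 0 < h x)
    (hc : 0 < c) (heig : ∀ x, ruelle p g h x = c * h x)
    (μ : Measure (ℕ → A)) [IsProbabilityMeasure μ] (hinv : μ.map shift = μ) :
    specEnt p μ ≤ ((-∫ x, g x ∂μ + Real.log c : ℝ) : EReal) := by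
  obtain ⟨D, hD⟩ := exists_relEnt_proj_ge p hα hg hh hpos hc heig μ hinv
  have hlim : Tendsto (fun n : ℕ => ((-∫ x, g x ∂μ + Real.log c + D / n : ℝ) : EReal)) atTop
      (nhds ((-∫ x, g x ∂μ + Real.log c : ℝ) : EReal)) := by
    refine (continuous_coe_real_ereal.tendsto _).comp ?_
    simpa using (tendsto_const_div_atTop_nhds_zero_nat D).const_add (-∫ x, g x ∂μ + Real.log c)
  rw [← hlim.limsup_eq, specEnt]
  refine limsup_le_limsup ?_
  filter_upwards [eventually_gt_atTop 0] with n hn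
  have hn' : (0 : ℝ) < n := Nat.cast_pos.2 hn
  have h1 : finEnt p μ n ≤ ((-(n * (∫ x, g x ∂μ - Real.log c) - D) : ℝ) : EReal) := by
    rw [finEnt, EReal.coe_neg]
    exact EReal.neg_le_neg_iff.2 (hD n)
  rw [← EReal.coe_inv]
  calc (((n : ℝ)⁻¹ : ℝ) : EReal) * finEnt p μ n
      ≤ (((n : ℝ)⁻¹ : ℝ) : EReal) * ((-(n * (∫ x, g x ∂μ - Real.log c) - D) : ℝ) : EReal) :=
        mul_le_mul_of_nonneg_left h1 (EReal.coe_nonneg.2 (by positivity))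
    _ = _ := by
        rw [← EReal.coe_mul]
        congr 1
        field_simp
        ring

/-- A potential obtained by averaging a normalized function of `n` coordinates has eigenvalue at
most `1`. -/
theorem eigenvalue_le_one (p : Measure A) [IsProbabilityMeasure p] [Nonempty A] {n : ℕ}
    (hn : 0 < n) {φ : (Fin n → A) → ℝ} (hφ : Continuous φ)
    (h1 : ∫ a, Real.exp (φ a) ∂(Measure.pi fun _ : Fin n => p) = 1) {h : (ℕ → A) → ℝ} {c : ℝ}
    (hh : Continuous h) (hpos : ∀ x, 0 < h x) (hc : 0 < c)
    (heig : ∀ x, ruelle p (fun x => (n : ℝ)⁻¹ * φ (proj n x)) h x = c * h x) : c ≤ 1 := by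
  have hgc : Continuous fun x : ℕ → A => (n : ℝ)⁻¹ * φ (proj n x) :=
    continuous_const.mul (hφ.comp (continuous_proj n))
  obtain ⟨K, hK, hKn⟩ := exists_integral_exp_birkhoff_bounds p hgc hh hpos hc heig
  by_contra! hc1
  obtain ⟨k, hk⟩ := pow_unbounded_of_one_lt K (one_lt_pow₀ hc1 hn.ne')
  have h2 := (hKn (n * k)).2
  have h3 := mul_le_mul_of_nonneg_left (integral_exp_birkhoff_average_le_one p hn hφ h1 k) hK.le
  rw [pow_mul] at h2
  linarith

theorem le_inv_mul_finEnt (p : Measure A) [IsProbabilityMeasure p] {α : ℝ} (hα0 : 0 < α)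
    (hα1 : α < 1) {lam : ((ℕ → A) → ℝ) → ℝ} {eigf : ((ℕ → A) → ℝ) → ((ℕ → A) → ℝ)}
    (hlam : ∀ g, IsHolder α g → 0 < lam g)
    (heigf : ∀ g, IsHolder α g → IsHolder α (eigf g) ∧ (∀ x, 0 < eigf g x) ∧
      ∀ x, ruelle p g (eigf g) x = lam g * eigf g x)
    (μ : Measure (ℕ → A)) [IsProbabilityMeasure μ] {b : ℝ} (hb : (b : EReal) ≤ hvEnt α lam μ)
    {n : ℕ} (hn : 0 < n) : (b : EReal) ≤ ((n : ℝ)⁻¹ : EReal) * finEnt p μ n := by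
  obtain ⟨y⟩ : Nonempty (ℕ → A) := Measure.nonempty_of_neZero μ
  have : Nonempty A := ⟨y 0⟩
  have hn' : (0 : ℝ) < n := Nat.cast_pos.2 hn
  have hproj := (continuous_proj (A := A) n).measurable.aemeasurable (μ := μ)
  have : IsProbabilityMeasure (μ.map (proj n)) := Measure.isProbabilityMeasure_map hproj
  set ν := Measure.pi fun _ : Fin n => p with hν
  have key : ∀ φ : (Fin n → A) → ℝ, (∃ K, LipschitzWith K φ) →
      ∫ a, φ a ∂(μ.map (proj n)) ≤ -(n * b) + Real.log (∫ a, Real.exp (φ a) ∂ν) := by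
    rintro φ ⟨K, hK⟩
    set L := Real.log (∫ a, Real.exp (φ a) ∂ν) with hL
    have hφ := hK.continuous
    have hφL : LipschitzWith K fun a => φ a - L := by
      refine LipschitzWith.of_dist_le_mul fun a a' => ?_
      rw [dist_sub_right]
      exact hK.dist_le_mul a a'
    have hpos : 0 < ∫ a, Real.exp (φ a) ∂ν :=
      integral_exp_pos (integrable_of_continuous _ (Real.continuous_exp.comp hφ))
    have h1 : ∫ a, Real.exp (φ a - L) ∂ν = 1 := by
      simp_rw [Real.exp_sub]
      rw [integral_div, hL, Real.exp_log hpos, div_self hpos.ne']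
    have hg := (isHolder_comp_proj hα1.le hφL).const_mul (n : ℝ)⁻¹
    obtain ⟨hh, hhpos, heig⟩ := heigf _ hg
    have hle := eigenvalue_le_one p hn hφL.continuous h1 (hh.continuous hα0) hhpos (hlam _ hg) heig
    have hlog := Real.log_nonpos (hlam _ hg).le hle
    have hinf : hvEnt α lam μ ≤ _ := sInf_le ⟨_, hg, rfl⟩
    have h2 := EReal.coe_le_coe_iff.1 (hb.trans hinf)
    have h3 : ∫ x, (n : ℝ)⁻¹ * (φ (proj n x) - L) ∂μ =
        (n : ℝ)⁻¹ * (∫ a, φ a ∂(μ.map (proj n)) - L) := by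
      have hi : Integrable (fun x => φ (proj n x)) μ :=
        integrable_of_continuous μ (hφ.comp (continuous_proj n))
      rw [integral_const_mul, integral_sub hi (integrable_const _),
        integral_map hproj hφ.measurable.aestronglyMeasurable]
      simp
    rw [h3] at h2
    have h4 : (n : ℝ)⁻¹ * (∫ a, φ a ∂(μ.map (proj n)) - L) ≤ -b := by linarith
    rw [inv_mul_le_iff₀ hn'] at h4
    linarith
  have hrel : relEnt (μ.map (proj n)) ν ≤ ((-(n * b) : ℝ) : EReal) :=
    relEnt_le_of_forall_bounded fun φ hφ ⟨M, hM⟩ =>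
      integral_le_add_log_integral_exp_of_lipschitzWith key hφ hM
  have hfin : ((n * b : ℝ) : EReal) ≤ finEnt p μ n := by
    rw [finEnt, EReal.le_neg, ← EReal.coe_neg]
    exact hrel
  rw [← EReal.coe_inv]
  calc (b : EReal) = (((n : ℝ)⁻¹ : ℝ) : EReal) * ((n * b : ℝ) : EReal) := by
        rw [← EReal.coe_mul, inv_mul_cancel_left₀ hn'.ne']
    _ ≤ _ := mul_le_mul_of_nonneg_left hfin (EReal.coe_nonneg.2 (by positivity))

/-- If to every `α`-Hölder `g` there are assigned `λ_g > 0` and a strictly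
positive `α`-Hölder eigenfunction `h_g` with `L_g h_g = λ_g h_g`, then for every
shift-invariant Borel probability measure `μ` the specific entropy satisfies
`h^s(μ) = h^v(μ)`. -/
theorem statement2
    (p : Measure A) [IsProbabilityMeasure p]
    (hsupp : ∀ U : Set A, IsOpen U → U.Nonempty → 0 < p U)
    (α : ℝ) (hα0 : 0 < α) (hα1 : α < 1)
    (lam : ((ℕ → A) → ℝ) → ℝ) (eigf : ((ℕ → A) → ℝ) → ((ℕ → A) → ℝ))
    (hlam : ∀ g, IsHolder α g → 0 < lam g)
    (heigf : ∀ g, IsHolder α g → IsHolder α (eigf g) ∧ (∀ x, 0 < eigf g x) ∧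
      ∀ x, ruelle p g (eigf g) x = lam g * eigf g x)
    (μ : Measure (ℕ → A)) [IsProbabilityMeasure μ]
    (hinv : μ.map shift = μ) :
    specEnt p μ = hvEnt α lam μ := by
  refine le_antisymm (le_sInf ?_) (EReal.ge_of_forall_gt_iff_ge.1 fun b hb => ?_)
  · rintro _ ⟨g, hg, rfl⟩
    obtain ⟨hh, hpos, heig⟩ := heigf g hg
    exact specEnt_le p hα0 hg (hh.continuous hα0) hpos (hlam g hg) heig μ hinv
  · refine le_limsup_of_frequently_le (Eventually.frequently ?_)
    filter_upwards [eventually_gt_atTop 0] with n hn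
    exact le_inv_mul_finEnt p hα0 hα1 hlam heigf μ hb.le hn

end Paper
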